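/- For any smooth function X^i on E* (the spatial components of a d-vector field), the h_M-Ricci identity holds: X^i_{|j|k} − X^i_{|k|j} = X^r R^i_rjk − X^i|^(r)_(f) R^(f)_(r)jk, where R^i_rjk = δH^i_rj/δx^k − δH^i_rk/δx^j + H^s_rj H^i_sk − H^s_rk H^i_sj + C^i(s)_r(f) R^(f)_(s)jk and R^(f)_(r)jk = δN2^(f)_(r)j/δx^k − δN2^(f)_(r)k/δx^j. -/

import Mathlib

noncomputable section

/-- The dual 1-jet space `E* = ℝ^m × ℝ^n × ℝ^(n×m)`, with coordinates
`(t^a, x^i, p_i^a)`. -/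
abbrev Es (m n : ℕ) : Type := (Fin m → ℝ) × (Fin n → ℝ) × (Fin n → Fin m → ℝ)

variable {m n : ℕ}

/-- Kronecker delta. -/
def kd {α : Type*} [DecidableEq α] (a b : α) : ℝ := if a = b then 1 else 0

/-- Partial derivative `∂/∂t^a` on `E*`. -/
def pt (a : Fin m) (F : Es m n → ℝ) (u : Es m n) : ℝ :=
  fderiv ℝ F u (Pi.single a 1, 0, 0)

/-- Partial derivative `∂/∂x^i` on `E*`. -/
def px (i : Fin n) (F : Es m n → ℝ) (u : Es m n) : ℝ :=
  fderiv ℝ F u (0, Pi.single i 1, 0)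

/-- Partial derivative `∂/∂p_i^a` on `E*`. -/
def pp (i : Fin n) (a : Fin m) (F : Es m n → ℝ) (u : Es m n) : ℝ :=
  fderiv ℝ F u (0, 0, Pi.single i (Pi.single a 1))

/-- Adapted derivative `δ/δt^a = ∂/∂t^a - N1^(b)_(j)a ∂/∂p_j^b` of the
nonlinear connection `N = (N1, N2)`; `N1 b j a` stands for `N1^(b)_(j)a`. -/
def dt (N1 : Fin m → Fin n → Fin m → Es m n → ℝ) (a : Fin m) (F : Es m n → ℝ)
    (u : Es m n) : ℝ :=
  pt a F u - ∑ b, ∑ j, N1 b j a u * pp j b F u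

/-- Adapted derivative `δ/δx^i = ∂/∂x^i - N2^(b)_(j)i ∂/∂p_j^b` of the
nonlinear connection `N = (N1, N2)`; `N2 b j i` stands for `N2^(b)_(j)i`. -/
def dx (N2 : Fin m → Fin n → Fin n → Es m n → ℝ) (i : Fin n) (F : Es m n → ℝ)
    (u : Es m n) : ℝ :=
  px i F u - ∑ b, ∑ j, N2 b j i u * pp j b F u

/-- Partial derivative `∂/∂t^c` on the temporal factor `ℝ^m`. -/
def ptm (c : Fin m) (f : (Fin m → ℝ) → ℝ) (t : Fin m → ℝ) : ℝ :=
  fderiv ℝ f t (Pi.single c 1)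

/-- Partial derivative `∂/∂x^k` on the spatial factor `ℝ^n`. -/
def pxn (k : Fin n) (f : (Fin n → ℝ) → ℝ) (x : Fin n → ℝ) : ℝ :=
  fderiv ℝ f x (Pi.single k 1)

/-! ### Christoffel symbols and their curvatures -/

/-- The Christoffel symbols of a (semi-Riemannian) metric `g` with inverse `ginv`
on `ℝ^k`: `γ^a_bc = (1/2) g^{ad} (∂g_db/∂t^c + ∂g_dc/∂t^b - ∂g_bc/∂t^d)`. -/
def christoffel {k : ℕ} (g ginv : Fin k → Fin k → (Fin k → ℝ) → ℝ)
    (a b c : Fin k) (t : Fin k → ℝ) : ℝ :=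
  (1 / 2) * ∑ d, ginv a d t *
    (ptm c (g d b) t + ptm b (g d c) t - ptm d (g b c) t)

/-- The curvature tensor of a family of Christoffel symbols `γ` on `ℝ^k`:
`γ^l_iab = ∂γ^l_ia/∂t^b - ∂γ^l_ib/∂t^a + γ^e_ia γ^l_eb - γ^e_ib γ^l_ea`. -/
def christoffelCurv {k : ℕ} (γ : Fin k → Fin k → Fin k → (Fin k → ℝ) → ℝ)
    (l i a b : Fin k) (t : Fin k → ℝ) : ℝ :=
  ptm b (γ l i a) t - ptm a (γ l i b) t +
    ∑ e, (γ e i a t * γ l e b t - γ e i b t * γ l e a t)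

/-! ### Torsion and curvature d-tensors of an h-normal N-linear connection
`(χ^a_bc, A^i_jc, H^i_jk, C^i(k)_j(c))` on `E*`.  Throughout, `A i j c` stands
for `A^i_jc`, `H i j k` for `H^i_jk` and `C i k j c` for `C^i(k)_j(c)`. -/

section Connection

variable (N1 : Fin m → Fin n → Fin m → Es m n → ℝ)
variable (N2 : Fin m → Fin n → Fin n → Es m n → ℝ)
variable (χ : Fin m → Fin m → Fin m → (Fin m → ℝ) → ℝ)
variable (A : Fin n → Fin n → Fin m → Es m n → ℝ)
variable (H : Fin n → Fin n → Fin n → Es m n → ℝ)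
variable (C : Fin n → Fin n → Fin n → Fin m → Es m n → ℝ)

/-- Torsion `R^(f)_(r)ab = δN1^(f)_(r)a/δt^b - δN1^(f)_(r)b/δt^a`. -/
def RR1 (f : Fin m) (r : Fin n) (a b : Fin m) (u : Es m n) : ℝ :=
  dt N1 b (N1 f r a) u - dt N1 a (N1 f r b) u

/-- Torsion `R^(f)_(r)aj = δN1^(f)_(r)a/δx^j - δN2^(f)_(r)j/δt^a`. -/
def RRmix (f : Fin m) (r : Fin n) (a : Fin m) (j : Fin n) (u : Es m n) : ℝ :=
  dx N2 j (N1 f r a) u - dt N1 a (N2 f r j) u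

/-- Torsion `R^(f)_(r)ij = δN2^(f)_(r)i/δx^j - δN2^(f)_(r)j/δx^i`. -/
def RR2 (f : Fin m) (r i j : Fin n) (u : Es m n) : ℝ :=
  dx N2 j (N2 f r i) u - dx N2 i (N2 f r j) u

/-- Torsion `P^(f)(j)_(r)a(b) = ∂N1^(f)_(r)a/∂p_j^b + δ^f_b A^j_ra - δ^j_r χ^f_ba`. -/
def Ptor1 (f : Fin m) (j : Fin n) (r : Fin n) (a b : Fin m) (u : Es m n) : ℝ :=
  pp j b (N1 f r a) u + kd f b * A j r a u - kd j r * χ f b a u.1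

/-- Torsion `P^(f)(j)_(r)i(b) = ∂N2^(f)_(r)i/∂p_j^b + δ^f_b H^j_ri`. -/
def Ptor2 (f : Fin m) (j r i : Fin n) (b : Fin m) (u : Es m n) : ℝ :=
  pp j b (N2 f r i) u + kd f b * H j r i u

/-- Torsion `S^(f)(j)(k)_(r)(b)(c) = -(δ^f_b C^j(k)_r(c) - δ^f_c C^k(j)_r(b))`. -/
def Stor (f : Fin m) (j k r : Fin n) (b c : Fin m) (u : Es m n) : ℝ :=
  -(kd f b * C j k r c u - kd f c * C k j r b u)

/-- The `T`-horizontal covariant derivative `C^l(k)_i(c)/b` of `C`. -/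
def CcovT (l k i : Fin n) (c : Fin m) (b : Fin m) (u : Es m n) : ℝ :=
  dt N1 b (C l k i c) u + ∑ s, C s k i c u * A l s b u -
    ∑ s, C l k s c u * A s i b u + ∑ s, C l s i c u * A k s b u -
    ∑ f, C l k i f u * χ f c b u.1

/-- The `M`-horizontal covariant derivative
`C^l(k)_i(c)|j = δC^l(k)_i(c)/δx^j + C^s(k)_i(c) H^l_sj - C^l(k)_s(c) H^s_ij
+ C^l(s)_i(c) H^k_sj` of `C`. -/
def CcovX (l k i : Fin n) (c : Fin m) (j : Fin n) (u : Es m n) : ℝ :=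
  dx N2 j (C l k i c) u + ∑ s, C s k i c u * H l s j u -
    ∑ s, C l k s c u * H s i j u + ∑ s, C l s i c u * H k s j u

/-- Curvature `R^l_ibc = δA^l_ib/δt^c - δA^l_ic/δt^b + A^r_ib A^l_rc
- A^r_ic A^l_rb + C^l(r)_i(f) R^(f)_(r)bc`. -/
def curvT (l i : Fin n) (b c : Fin m) (u : Es m n) : ℝ :=
  dt N1 c (A l i b) u - dt N1 b (A l i c) u +
    ∑ r, (A r i b u * A l r c u - A r i c u * A l r b u) +
    ∑ r, ∑ f, C l r i f u * RR1 N1 f r b c u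

/-- Curvature `R^l_ibk = δA^l_ib/δx^k - δH^l_ik/δt^b + A^r_ib H^l_rk
- H^r_ik A^l_rb + C^l(r)_i(f) R^(f)_(r)bk`. -/
def curvMix (l i : Fin n) (b : Fin m) (k : Fin n) (u : Es m n) : ℝ :=
  dx N2 k (A l i b) u - dt N1 b (H l i k) u +
    ∑ r, (A r i b u * H l r k u - H r i k u * A l r b u) +
    ∑ r, ∑ f, C l r i f u * RRmix N1 N2 f r b k u

/-- Curvature `R^l_ijk = δH^l_ij/δx^k - δH^l_ik/δx^j + H^r_ij H^l_rk
- H^r_ik H^l_rj + C^l(r)_i(f) R^(f)_(r)jk`. -/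
def curvH (l i j k : Fin n) (u : Es m n) : ℝ :=
  dx N2 k (H l i j) u - dx N2 j (H l i k) u +
    ∑ r, (H r i j u * H l r k u - H r i k u * H l r j u) +
    ∑ r, ∑ f, C l r i f u * RR2 N2 f r j k u

/-- Curvature `P^l(k)_ib(c) = ∂A^l_ib/∂p_k^c - C^l(k)_i(c)/b
+ C^l(r)_i(f) P^(f)(k)_(r)b(c)`. -/
def curvP1 (l i : Fin n) (b : Fin m) (k : Fin n) (c : Fin m) (u : Es m n) : ℝ :=
  pp k c (A l i b) u - CcovT N1 χ A C l k i c b u +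
    ∑ r, ∑ f, C l r i f u * Ptor1 N1 χ A f k r b c u

/-- Curvature `P^l(k)_ij(c) = ∂H^l_ij/∂p_k^c - C^l(k)_i(c)|j
+ C^l(r)_i(f) P^(f)(k)_(r)j(c)`. -/
def curvP2 (l i j k : Fin n) (c : Fin m) (u : Es m n) : ℝ :=
  pp k c (H l i j) u - CcovX N2 H C l k i c j u +
    ∑ r, ∑ f, C l r i f u * Ptor2 N2 H f k r j c u

/-- Curvature `S^l(j)(k)_i(b)(c) = ∂C^l(j)_i(b)/∂p_k^c - ∂C^l(k)_i(c)/∂p_j^b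
+ C^r(j)_i(b) C^l(k)_r(c) - C^r(k)_i(c) C^l(j)_r(b)`. -/
def curvS (l j k i : Fin n) (b c : Fin m) (u : Es m n) : ℝ :=
  pp k c (C l j i b) u - pp j b (C l k i c) u +
    ∑ r, (C r j i b u * C l k r c u - C r k i c u * C l j r b u)

end Connection

section Ricci10

variable (N2 : Fin m → Fin n → Fin n → Es m n → ℝ)
variable (H : Fin n → Fin n → Fin n → Es m n → ℝ)
variable (C : Fin n → Fin n → Fin n → Fin m → Es m n → ℝ)

/-- `M`-horizontal covariant derivative `X^i_{|j} = δX^i/δx^j + X^r H^i_rj` of the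
spatial components of a d-vector field. -/
def covXs (X : Fin n → Es m n → ℝ) (i j : Fin n) (u : Es m n) : ℝ :=
  dx N2 j (X i) u + ∑ r, X r u * H i r j u

/-- Second covariant derivative
`X^i_{|j|k} = δ(X^i_{|j})/δx^k + X^r_{|j} H^i_rk - X^i_{|r} H^r_jk`. -/
def covXs2 (X : Fin n → Es m n → ℝ) (i j k : Fin n) (u : Es m n) : ℝ :=
  dx N2 k (fun v => covXs N2 H X i j v) u + ∑ r, covXs N2 H X r j u * H i r k u -
    ∑ r, covXs N2 H X i r u * H r j k u

/-- Vertical covariant derivative `X^i|^(r)_(f) = ∂X^i/∂p_r^f + X^j C^i(r)_j(f)`. -/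
def vertXs (X : Fin n → Es m n → ℝ) (i r : Fin n) (f : Fin m) (u : Es m n) : ℝ :=
  pp r f (X i) u + ∑ j, X j u * C i r j f u

end Ricci10

/-- The adapted frame vector `δ/δx^i` at `u`. -/
def wv (N2 : Fin m → Fin n → Fin n → Es m n → ℝ) (i : Fin n) (u : Es m n) : Es m n :=
  ((0, Pi.single i 1, 0) : Es m n) -
    ∑ b, ∑ j, N2 b j i u • ((0, 0, Pi.single j (Pi.single b 1)) : Es m n)

theorem dx_eq (N2 : Fin m → Fin n → Fin n → Es m n → ℝ) (i : Fin n) (F : Es m n → ℝ)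
    (u : Es m n) : dx N2 i F u = fderiv ℝ F u (wv N2 i u) := by
  simp only [dx, px, pp, wv, map_sub, map_sum, map_smul, smul_eq_mul]

theorem dirSmooth {F : Es m n → ℝ} (hF : ContDiff ℝ (⊤ : ℕ∞) F) (v : Es m n) :
    ContDiff ℝ (⊤ : ℕ∞) (fun u => fderiv ℝ F u v) :=
  (hF.fderiv_right (m := (⊤ : ℕ∞)) (by simp)).clm_apply contDiff_const

theorem dir2 {F : Es m n → ℝ} (hF : ContDiff ℝ (⊤ : ℕ∞) F) (v w u : Es m n) :
    fderiv ℝ (fun u => fderiv ℝ F u v) u w = fderiv ℝ (fderiv ℝ F) u w v := by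
  have hd : DifferentiableAt ℝ (fderiv ℝ F) u :=
    ((hF.fderiv_right (m := (⊤ : ℕ∞)) (by simp)).differentiable (by simp)) u
  rw [fderiv_clm_apply hd (differentiableAt_const v)]
  simp

theorem dx_add (N2 : Fin m → Fin n → Fin n → Es m n → ℝ) (i : Fin n) {F G : Es m n → ℝ}
    (u : Es m n) (hF : DifferentiableAt ℝ F u) (hG : DifferentiableAt ℝ G u) :
    dx N2 i (fun v => F v + G v) u = dx N2 i F u + dx N2 i G u := by
  simp only [dx_eq]; rw [fderiv_fun_add hF hG]; rfl

theorem dx_sub (N2 : Fin m → Fin n → Fin n → Es m n → ℝ) (i : Fin n) {F G : Es m n → ℝ}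
    (u : Es m n) (hF : DifferentiableAt ℝ F u) (hG : DifferentiableAt ℝ G u) :
    dx N2 i (fun v => F v - G v) u = dx N2 i F u - dx N2 i G u := by
  simp only [dx_eq]; rw [fderiv_fun_sub hF hG]; rfl

theorem dx_mul (N2 : Fin m → Fin n → Fin n → Es m n → ℝ) (i : Fin n) {F G : Es m n → ℝ}
    (u : Es m n) (hF : DifferentiableAt ℝ F u) (hG : DifferentiableAt ℝ G u) :
    dx N2 i (fun v => F v * G v) u = F u * dx N2 i G u + dx N2 i F u * G u := by
  simp only [dx_eq]; rw [fderiv_fun_mul hF hG]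
  simp [mul_comm]

theorem dx_sum (N2 : Fin m → Fin n → Fin n → Es m n → ℝ) (i : Fin n) {ι : Type} [Fintype ι]
    {F : ι → Es m n → ℝ} (u : Es m n) (hF : ∀ a, DifferentiableAt ℝ (F a) u) :
    dx N2 i (fun v => ∑ a, F a v) u = ∑ a, dx N2 i (F a) u := by
  simp only [dx_eq]; rw [fderiv_fun_sum (fun a _ => hF a)]
  simp

theorem dx_diff {N2 : Fin m → Fin n → Fin n → Es m n → ℝ}
    (hN2 : ∀ e r i, ContDiff ℝ (⊤ : ℕ∞) (N2 e r i)) (i : Fin n) {F : Es m n → ℝ}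
    (hF : ContDiff ℝ (⊤ : ℕ∞) F) : ContDiff ℝ (⊤ : ℕ∞) (fun v => dx N2 i F v) := by
  unfold dx px pp
  refine (dirSmooth hF _).sub (ContDiff.sum fun b _ => ContDiff.sum fun j _ => ?_)
  exact (hN2 b j i).mul (dirSmooth hF _)

theorem sdiff {F : Es m n → ℝ} (hF : ContDiff ℝ (⊤ : ℕ∞) F) (u : Es m n) :
    DifferentiableAt ℝ F u := (hF.differentiable (by simp)) u

theorem dx_dx {N2 : Fin m → Fin n → Fin n → Es m n → ℝ}
    (hN2 : ∀ e r i, ContDiff ℝ (⊤ : ℕ∞) (N2 e r i)) (j k : Fin n) {F : Es m n → ℝ}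
    (hF : ContDiff ℝ (⊤ : ℕ∞) F) (u : Es m n) :
    dx N2 k (fun v => dx N2 j F v) u =
      fderiv ℝ (fderiv ℝ F) u (wv N2 k u) (wv N2 j u) -
        ∑ b, ∑ r, dx N2 k (N2 b r j) u * pp r b F u := by
  have hp : ∀ r b, ContDiff ℝ (⊤ : ℕ∞) (fun v => pp r b F v) := fun r b => dirSmooth hF _
  have hq : ContDiff ℝ (⊤ : ℕ∞) (fun v => px j F v) := dirSmooth hF _
  have hm : ∀ b r, ContDiff ℝ (⊤ : ℕ∞) (fun v => N2 b r j v * pp r b F v) :=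
    fun b r => (hN2 b r j).mul (hp r b)
  have h1 : dx N2 k (fun v => dx N2 j F v) u = dx N2 k (fun v => px j F v) u -
      ∑ b, ∑ r, (N2 b r j u * dx N2 k (fun v => pp r b F v) u
        + dx N2 k (N2 b r j) u * pp r b F u) := by
    have : (fun v => dx N2 j F v) =
      fun v => px j F v - ∑ b, ∑ r, N2 b r j v * pp r b F v := rfl
    rw [this, dx_sub _ _ _ (sdiff hq u)
      (sdiff (ContDiff.sum fun b _ => ContDiff.sum fun r _ => hm b r) u),
      dx_sum _ _ _ (fun b => sdiff (ContDiff.sum fun r _ => hm b r) u)]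
    congr 1
    refine Finset.sum_congr rfl fun b _ => ?_
    rw [dx_sum _ _ _ (fun r => sdiff (hm b r) u)]
    refine Finset.sum_congr rfl fun r _ => ?_
    rw [dx_mul _ _ _ (sdiff (hN2 b r j) u) (sdiff (hp r b) u)]
  have h2 : dx N2 k (fun v => px j F v) u =
      fderiv ℝ (fderiv ℝ F) u (wv N2 k u) (0, Pi.single j 1, 0) := by
    rw [dx_eq]; exact dir2 hF _ _ _
  have h3 : ∀ r b, dx N2 k (fun v => pp r b F v) u =
      fderiv ℝ (fderiv ℝ F) u (wv N2 k u) (0, 0, Pi.single r (Pi.single b 1)) := by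
    intro r b; rw [dx_eq]; exact dir2 hF _ _ _
  rw [h1, h2]
  simp only [h3, Finset.sum_add_distrib]
  generalize fderiv ℝ (fderiv ℝ F) u (wv N2 k u) = L
  simp only [wv, map_sub, map_sum, map_smul, smul_eq_mul]
  ring

theorem dx_comm {N2 : Fin m → Fin n → Fin n → Es m n → ℝ}
    (hN2 : ∀ e r i, ContDiff ℝ (⊤ : ℕ∞) (N2 e r i)) (j k : Fin n) {F : Es m n → ℝ}
    (hF : ContDiff ℝ (⊤ : ℕ∞) F) (u : Es m n) :
    dx N2 k (fun v => dx N2 j F v) u - dx N2 j (fun v => dx N2 k F v) u =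
      - ∑ b, ∑ r, pp r b F u * RR2 N2 b r j k u := by
  have hs : fderiv ℝ (fderiv ℝ F) u (wv N2 k u) (wv N2 j u) =
      fderiv ℝ (fderiv ℝ F) u (wv N2 j u) (wv N2 k u) := by
    have : IsSymmSndFDerivAt ℝ F u := hF.contDiffAt.isSymmSndFDerivAt
      (by rw [minSmoothness_of_isRCLikeNormedField]; exact WithTop.coe_le_coe.2 (le_top : (2 : ℕ∞) ≤ ⊤))
    exact this _ _
  rw [dx_dx hN2 j k hF, dx_dx hN2 k j hF, hs]
  simp only [RR2, mul_comm (pp _ _ _ _)]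
  simp only [sub_mul, Finset.sum_sub_distrib]
  ring

/-- For any smooth `X^i` on `E*`, the `h_M`-Ricci identity of an
`h`-normal `N`-linear connection of Cartan type holds:
`X^i_{|j|k} - X^i_{|k|j} = X^r R^i_rjk - X^i|^(r)_(f) R^(f)_(r)jk`. -/
theorem hM_Ricci_identity (m n : ℕ) (hm : 1 ≤ m) (hn : 1 ≤ n)
    -- the temporal metric `h`, its inverse, and its Christoffel symbols `χ`
    (h hinv : Fin m → Fin m → (Fin m → ℝ) → ℝ)
    (hsmooth : ∀ a b, ContDiff ℝ (⊤ : ℕ∞) (h a b)) (hinvsmooth : ∀ a b, ContDiff ℝ (⊤ : ℕ∞) (hinv a b))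
    (hsym : ∀ t a b, h a b t = h b a t)
    (hinverse : ∀ t a b, ∑ f, hinv a f t * h f b t = kd a b)
    (χ : Fin m → Fin m → Fin m → (Fin m → ℝ) → ℝ)
    (hχ : ∀ a b c t, χ a b c t = christoffel h hinv a b c t)
    -- the nonlinear connection `N = (N1, N2)`
    (N1 : Fin m → Fin n → Fin m → Es m n → ℝ)
    (N2 : Fin m → Fin n → Fin n → Es m n → ℝ)
    (hN1 : ∀ e r a, ContDiff ℝ (⊤ : ℕ∞) (N1 e r a)) (hN2 : ∀ e r i, ContDiff ℝ (⊤ : ℕ∞) (N2 e r i))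
    -- the remaining components `A^i_jc`, `H^i_jk`, `C^i(k)_j(c)` of the
    -- `h`-normal `N`-linear connection of Cartan type `CDΓ(N)`
    (A : Fin n → Fin n → Fin m → Es m n → ℝ)
    (H : Fin n → Fin n → Fin n → Es m n → ℝ)
    (C : Fin n → Fin n → Fin n → Fin m → Es m n → ℝ)
    (hAs : ∀ i j c, ContDiff ℝ (⊤ : ℕ∞) (A i j c)) (hHs : ∀ i j k, ContDiff ℝ (⊤ : ℕ∞) (H i j k))
    (hCs : ∀ i k j c, ContDiff ℝ (⊤ : ℕ∞) (C i k j c))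
    (hHsym : ∀ i j k (u : Es m n), H i j k u = H i k j u)
    (hCsym : ∀ i k j c (u : Es m n), C i k j c u = C k i j c u)
    -- the spatial components of a d-vector field
    (X : Fin n → Es m n → ℝ) (hX : ∀ i, ContDiff ℝ (⊤ : ℕ∞) (X i)) :
    ∀ (u : Es m n) (i j k : Fin n),
      covXs2 N2 H X i j k u - covXs2 N2 H X i k j u =
        (∑ r, X r u * curvH N2 H C i r j k u) -
          ∑ f, ∑ r, vertXs C X i r f u * RR2 N2 f r j k u := by
  intro u i j k
  have hc : ∀ j k, dx N2 k (fun v => covXs N2 H X i j v) u =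
      dx N2 k (fun v => dx N2 j (X i) v) u +
        ∑ r, (X r u * dx N2 k (H i r j) u + dx N2 k (X r) u * H i r j u) := by
    intro j k
    have hm : ∀ r, ContDiff ℝ (⊤ : ℕ∞) (fun v => X r v * H i r j v) :=
      fun r => (hX r).mul (hHs i r j)
    have : (fun v => covXs N2 H X i j v) =
      fun v => dx N2 j (X i) v + ∑ r, X r v * H i r j v := rfl
    rw [this, dx_add _ _ _ (sdiff (dx_diff hN2 j (hX i)) u)
      (sdiff (ContDiff.sum fun r _ => hm r) u), dx_sum _ _ _ (fun r => sdiff (hm r) u)]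
    congr 1
    refine Finset.sum_congr rfl fun r _ => ?_
    rw [dx_mul _ _ _ (sdiff (hX r) u) (sdiff (hHs i r j) u)]
  have hcomm := dx_comm hN2 j k (hX i) u
  have hT : ∑ r, covXs N2 H X i r u * H r k j u = ∑ r, covXs N2 H X i r u * H r j k u :=
    Finset.sum_congr rfl fun r _ => by rw [hHsym r k j u]
  have hq : ∀ j k, ∑ r, covXs N2 H X r j u * H i r k u =
      ∑ r, dx N2 j (X r) u * H i r k u + ∑ r, X r u * ∑ s, H s r j u * H i s k u := by
    intro j k
    simp only [covXs, add_mul, Finset.sum_add_distrib, Finset.sum_mul, Finset.mul_sum]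
    congr 1
    rw [Finset.sum_comm]
    simp only [mul_assoc]
  have hv : ∑ f, ∑ r, vertXs C X i r f u * RR2 N2 f r j k u =
      ∑ f, ∑ r, pp r f (X i) u * RR2 N2 f r j k u +
        ∑ s, X s u * ∑ r, ∑ f, C i r s f u * RR2 N2 f r j k u := by
    simp only [vertXs, add_mul, Finset.sum_add_distrib, Finset.sum_mul, Finset.mul_sum]
    congr 1
    rw [Finset.sum_comm]
    conv_rhs => rw [Finset.sum_comm]
    refine Finset.sum_congr rfl fun r _ => ?_
    rw [Finset.sum_comm]
    simp only [mul_assoc]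
  rw [hv]
  simp only [covXs2, hc, hT, hq, curvH]
  simp only [mul_add, mul_sub, Finset.sum_add_distrib, Finset.sum_sub_distrib]
  linarith [hcomm]
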